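/- arXiv:math/9802051 — 2 statements merged into one kernel-verified Lean document; each statement's English description precedes it below -/
import Mathlib

section
/- Let K be a field, V a finite-dimensional K-vector space, and N : V → V a nilpotent K-linear endomorphism with monodromy weight filtration W. Then for every k ≥ 0, the dimension of the primitive part P_k satisfies dim P_k + 2 · rank(N^{k+1}) = rank(N^k) + rank(N^{k+2}), where rank denotes the dimension of the range of a linear map and N^0 = id. -/
variable {K V : Type*} [Field K] [AddCommGroup V] [Module K V]

/-- The `k`-th graded piece `Gr_k = (W k)/(W (k-1))` of a `ℤ`-indexed filtration `W`. -/
abbrev gradedPiece (W : ℤ → Submodule K V) (k : ℤ) :=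
  W k ⧸ (Submodule.comap (W k).subtype (W (k - 1)))

/-- The map `Gr_k → Gr_m` induced by a linear map `f` with `f (W k) ⊆ W m` and
`f (W (k-1)) ⊆ W (m-1)`. -/
def inducedMap (W : ℤ → Submodule K V) (f : V →ₗ[K] V) (k m : ℤ)
    (h1 : ∀ x ∈ W k, f x ∈ W m)
    (h2 : ∀ x ∈ W (k - 1), f x ∈ W (m - 1)) :
    gradedPiece W k →ₗ[K] gradedPiece W m :=
  Submodule.mapQ _ _ (f.restrict h1) (fun x hx => h2 x.1 hx)

/-- `W` is a monodromy weight filtration for the nilpotent endomorphism `N`. -/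
structure IsMonodromyWeightFiltration (W : ℤ → Submodule K V) (N : V →ₗ[K] V) : Prop where
  mono : Monotone W
  eventually_bot : ∃ a : ℤ, ∀ k : ℤ, k ≤ a → W k = ⊥
  eventually_top : ∃ b : ℤ, ∀ k : ℤ, b ≤ k → W k = ⊤
  map_le : ∀ k : ℤ, ∀ x ∈ W k, N x ∈ W (k - 2)
  pow_maps : ∀ k : ℤ, 0 ≤ k → ∀ x ∈ W k, (N ^ k.toNat) x ∈ W (-k)
  pow_maps' : ∀ k : ℤ, 0 ≤ k → ∀ x ∈ W (k - 1), (N ^ k.toNat) x ∈ W (-k - 1)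
  bijective : ∀ (k : ℤ) (hk : 0 ≤ k),
    Function.Bijective (inducedMap W (N ^ k.toNat) k (-k) (pow_maps k hk) (pow_maps' k hk))

theorem IsMonodromyWeightFiltration.pow_mem {W : ℤ → Submodule K V} {N : V →ₗ[K] V}
    (hW : IsMonodromyWeightFiltration W N) {j : ℕ} {k m : ℤ} (h : m = k - 2 * j) :
    ∀ x ∈ W k, (N ^ j) x ∈ W m := by
  subst h
  induction j generalizing k with
  | zero => intro x hx; simpa using hx
  | succ n ih =>
      intro x hx
      have h2 := ih (k := k - 2) (N x) (hW.map_le k x hx)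
      have he : (N ^ (n + 1)) x = (N ^ n) (N x) := by
        rw [pow_succ]; rfl
      rw [he]
      convert h2 using 2
      push_cast; ring

theorem IsMonodromyWeightFiltration.map_mem {W : ℤ → Submodule K V} {N : V →ₗ[K] V}
    (hW : IsMonodromyWeightFiltration W N) {k m : ℤ} (h : m = k - 2) :
    ∀ x ∈ W k, N x ∈ W m := h ▸ hW.map_le k

theorem inducedMap_mk {W : ℤ → Submodule K V} {f : V →ₗ[K] V} {k m : ℤ}
    (h1 : ∀ x ∈ W k, f x ∈ W m) (h2 : ∀ x ∈ W (k - 1), f x ∈ W (m - 1)) (x : W k) :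
    inducedMap W f k m h1 h2 (Submodule.Quotient.mk x) =
      Submodule.Quotient.mk ⟨f x.1, h1 x.1 x.2⟩ := rfl

theorem IsMonodromyWeightFiltration.inj' {W : ℤ → Submodule K V} {N : V →ₗ[K] V}
    (hW : IsMonodromyWeightFiltration W N) (m : ℕ) (x : V) (hx : x ∈ W m)
    (h : (N ^ m) x ∈ W (-(m : ℤ) - 1)) : x ∈ W ((m : ℤ) - 1) := by
  have hb := (hW.bijective (m : ℤ) (by omega)).1
  have h0 := (injective_iff_map_eq_zero _).1 hb (Submodule.Quotient.mk ⟨x, hx⟩) (by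
    rw [inducedMap_mk]
    refine (Submodule.Quotient.mk_eq_zero _).2 ?_
    simpa using h)
  simpa using (Submodule.Quotient.mk_eq_zero _).1 h0

theorem IsMonodromyWeightFiltration.surj' {W : ℤ → Submodule K V} {N : V →ₗ[K] V}
    (hW : IsMonodromyWeightFiltration W N) (m : ℕ) (y : V) (hy : y ∈ W (-(m : ℤ))) :
    ∃ x ∈ W m, (N ^ m) x - y ∈ W (-(m : ℤ) - 1) := by
  obtain ⟨q, hq⟩ := (hW.bijective (m : ℤ) (by omega)).2 (Submodule.Quotient.mk ⟨y, hy⟩)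
  obtain ⟨x, rfl⟩ := Submodule.Quotient.mk_surjective _ q
  rw [inducedMap_mk] at hq
  have := (Submodule.Quotient.eq _).1 hq
  exact ⟨x.1, x.2, by simpa using this⟩

theorem IsMonodromyWeightFiltration.finrank_graded [FiniteDimensional K V]
    {W : ℤ → Submodule K V} {N : V →ₗ[K] V}
    (hW : IsMonodromyWeightFiltration W N) (k : ℤ) :
    Module.finrank K (gradedPiece W k) + Module.finrank K (W (k - 1)) =
      Module.finrank K (W k) := by
  rw [← Submodule.finrank_quotient_add_finrank (Submodule.comap (W k).subtype (W (k - 1)))]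
  congr 1
  exact (Submodule.comapSubtypeEquivOfLe (hW.mono (by omega))).finrank_eq.symm

theorem IsMonodromyWeightFiltration.mem_of_pow_mem
    {W : ℤ → Submodule K V} {N : V →ₗ[K] V}
    (hW : IsMonodromyWeightFiltration W N) (j : ℕ) (x : V)
    (h : (N ^ j) x ∈ W (-(j : ℤ) - 1)) : x ∈ W ((j : ℤ) - 1) := by
  have key : ∀ d : ℕ, x ∈ W ((j : ℤ) - 1 + d) → x ∈ W ((j : ℤ) - 1) := by
    intro d
    induction d with
    | zero => intro hx; simpa using hx
    | succ d ih =>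
      intro hx
      apply ih
      have h1 : (N ^ (j + d)) x ∈ W (-((j + d : ℕ) : ℤ) - 1) := by
        rw [add_comm, pow_add]
        exact hW.mono (by push_cast; omega)
          (hW.pow_mem (j := d) (m := -(j : ℤ) - 1 - 2 * d) rfl _ h)
      have := hW.inj' (j + d) x (hW.mono (by push_cast; omega) hx) h1
      exact hW.mono (by push_cast; omega) this
  obtain ⟨b, hb⟩ := hW.eventually_top
  apply key (b - j + 1).toNat
  rw [hb _ (by omega)]
  trivial

theorem IsMonodromyWeightFiltration.exists_of_mem
    {W : ℤ → Submodule K V} {N : V →ₗ[K] V}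
    (hW : IsMonodromyWeightFiltration W N) (j : ℕ) (y : V)
    (hy : y ∈ W (-(j : ℤ) - 1)) : ∃ x ∈ W ((j : ℤ) - 1), (N ^ j) x = y := by
  obtain ⟨a, ha⟩ := hW.eventually_bot
  have key : ∀ d e : ℕ, -(j : ℤ) - 1 - e - d ≤ a → ∀ y ∈ W (-(j : ℤ) - 1 - e),
      ∃ x ∈ W ((j : ℤ) - 1), (N ^ j) x = y := by
    intro d
    induction d with
    | zero =>
      intro e he y hy
      rw [ha _ (by simpa using he)] at hy
      exact ⟨0, Submodule.zero_mem _, by rw [(Submodule.mem_bot K).1 hy, map_zero]⟩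
    | succ d ih =>
      intro e he y hy
      obtain ⟨x, hx, hxy⟩ := hW.surj' (j + (e + 1)) y (hW.mono (by push_cast; omega) hy)
      obtain ⟨z, hz, hzy⟩ := ih (e + 1) (by push_cast at he ⊢; omega) _
        (hW.mono (by push_cast; omega) hxy)
      refine ⟨(N ^ (e + 1)) x - z, Submodule.sub_mem _ ?_ hz, ?_⟩
      · exact hW.mono (by push_cast; omega) (hW.pow_mem (j := e + 1) rfl _ hx)
      · rw [map_sub, hzy, pow_add N j, Module.End.mul_apply]
        abel
  exact key ((-(j : ℤ) - 1 - a).toNat) 0 (by push_cast; omega) y (by simpa using hy)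

theorem IsMonodromyWeightFiltration.rank_pow [FiniteDimensional K V]
    {W : ℤ → Submodule K V} {N : V →ₗ[K] V}
    (hW : IsMonodromyWeightFiltration W N) (j : ℕ) :
    Module.finrank K (LinearMap.range (N ^ j)) + Module.finrank K (W ((j : ℤ) - 1)) =
      Module.finrank K V + Module.finrank K (W (-(j : ℤ) - 1)) := by
  have h1 := LinearMap.finrank_range_add_finrank_ker (N ^ j)
  have h2 := LinearMap.finrank_range_add_finrank_ker ((N ^ j).domRestrict (W ((j : ℤ) - 1)))
  have h3 : LinearMap.range ((N ^ j).domRestrict (W ((j : ℤ) - 1))) = W (-(j : ℤ) - 1) := by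
    ext y
    constructor
    · rintro ⟨x, rfl⟩
      exact hW.pow_mem (j := j) (by omega) _ x.2
    · intro hy
      obtain ⟨x, hx, hxy⟩ := hW.exists_of_mem j y hy
      exact ⟨⟨x, hx⟩, hxy⟩
  have h4 : Module.finrank K (LinearMap.ker ((N ^ j).domRestrict (W ((j : ℤ) - 1)))) =
      Module.finrank K (LinearMap.ker (N ^ j)) := by
    rw [LinearMap.ker_domRestrict]
    refine (Submodule.comapSubtypeEquivOfLe ?_).finrank_eq
    intro x hx
    apply hW.mem_of_pow_mem j x
    rw [LinearMap.mem_ker.1 hx]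
    exact Submodule.zero_mem _
  rw [h3, h4] at h2
  omega

/-- For `k ≥ 0`,
`dim P_k + 2 · rank N^{k+1} = rank N^k + rank N^{k+2}`. -/
theorem finrank_primitive_add_two_mul_rank [FiniteDimensional K V]
    {N : V →ₗ[K] V} (hN : IsNilpotent N)
    {W : ℤ → Submodule K V} (hW : IsMonodromyWeightFiltration W N) (k : ℕ) :
    Module.finrank K (LinearMap.ker (inducedMap W (N ^ (k + 1)) (k : ℤ) (-(k : ℤ) - 2)
        (hW.pow_mem (by omega)) (hW.pow_mem (by omega)))) +
      2 * Module.finrank K (LinearMap.range (N ^ (k + 1))) =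
    Module.finrank K (LinearMap.range (N ^ k)) +
      Module.finrank K (LinearMap.range (N ^ (k + 2))) := by
  have hs : LinearMap.range (inducedMap W (N ^ (k + 1)) (k : ℤ) (-(k : ℤ) - 2)
        (hW.pow_mem (by omega)) (hW.pow_mem (by omega))) = ⊤ := by
    rw [LinearMap.range_eq_top]
    intro q
    obtain ⟨y, rfl⟩ := Submodule.Quotient.mk_surjective _ q
    obtain ⟨x, hx, hxy⟩ := hW.surj' (k + 2) y.1 (hW.mono (by push_cast; omega) y.2)
    refine ⟨Submodule.Quotient.mk ⟨N x, hW.map_mem (by push_cast; omega) x hx⟩, ?_⟩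
    rw [inducedMap_mk]
    refine (Submodule.Quotient.eq _).2 ?_
    have : (N ^ (k + 1)) (N x) - y.1 ∈ W (-(k : ℤ) - 2 - 1) := by
      rw [← Module.End.mul_apply, ← pow_succ]
      exact hW.mono (by push_cast; omega) hxy
    simpa using this
  have h1 := LinearMap.finrank_range_add_finrank_ker
    (inducedMap W (N ^ (k + 1)) (k : ℤ) (-(k : ℤ) - 2)
        (hW.pow_mem (by omega)) (hW.pow_mem (by omega)))
  rw [hs, finrank_top] at h1
  have h2 := (LinearEquiv.ofBijective _ (hW.bijective ((k : ℤ) + 1) (by omega))).finrank_eq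
  have g1 := hW.finrank_graded k
  have g2 := hW.finrank_graded (-(k : ℤ) - 2)
  have g3 := hW.finrank_graded ((k : ℤ) + 1)
  have g4 := hW.finrank_graded (-((k : ℤ) + 1))
  have r0 := hW.rank_pow k
  have r1 := hW.rank_pow (k + 1)
  have r2 := hW.rank_pow (k + 2)
  have c : ∀ a b : ℤ, a = b → Module.finrank K (W a) = Module.finrank K (W b) := by
    rintro a _ rfl
    rfl
  have c1 := c ((k : ℤ) + 1 - 1) k (by ring)
  have c2 := c (-((k : ℤ) + 1) - 1) (-(k : ℤ) - 2) (by ring)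
  have c3 := c (((k + 2 : ℕ) : ℤ) - 1) (k + 1) (by push_cast; ring)
  have c4 := c (-((k + 2 : ℕ) : ℤ) - 1) (-(k : ℤ) - 2 - 1) (by push_cast; ring)
  have c5 := c (-(k : ℤ) - 1) (-((k : ℤ) + 1)) (by ring)
  have c6 := c (((k + 1 : ℕ) : ℤ) - 1) k (by push_cast; ring)
  have c7 := c (-((k + 1 : ℕ) : ℤ) - 1) (-(k : ℤ) - 2) (by push_cast; ring)
  rw [c1] at g3
  rw [c2] at g4
  rw [c3, c4] at r2
  rw [c5] at r0
  rw [c6, c7] at r1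
  clear c1 c2 c3 c4 c5 c6 c7 c
  omega
end

section
/- Let K be a field, V a finite-dimensional K-vector space, N : V → V a nilpotent K-linear endomorphism with monodromy weight filtration W, G a group, ρ : G →* (V ≃ₗ[K] V) a representation of G by K-linear automorphisms of V, and χ : G →* Kˣ a group homomorphism such that ρ(g) ∘ N ∘ ρ(g)⁻¹ = χ(g) • N for all g ∈ G. Then for every g ∈ G and k ∈ ℤ: (a) ρ(g)(W k) = W k, so ρ(g) induces an automorphism of Gr_k = (W k)/(W (k−1)); and (b) for every k ≥ 0, this induced automorphism of Gr_k maps the primitive part P_k = ker(N̄^{k+1} : Gr_k → Gr_{−k−2}) onto itself. -/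
variable {K V : Type*} [Field K] [AddCommGroup V] [Module K V]

theorem inducedMap_mk_eq_zero (W : ℤ → Submodule K V) (f : V →ₗ[K] V) (k m : ℤ)
    (h1 : ∀ x ∈ W k, f x ∈ W m) (h2 : ∀ x ∈ W (k - 1), f x ∈ W (m - 1)) (x : W k) :
    inducedMap W f k m h1 h2 (Submodule.Quotient.mk x) = 0 ↔ f x.1 ∈ W (m - 1) := by
  unfold inducedMap
  erw [Submodule.mapQ_apply, Submodule.Quotient.mk_eq_zero]
  rfl

/-- Elements killed by `N ^ (k+1)` lie in `W k`. -/
theorem IsMonodromyWeightFiltration.ker_le {W : ℤ → Submodule K V} {N : V →ₗ[K] V}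
    (hW : IsMonodromyWeightFiltration W N) (k : ℕ) (x : V) (hx : (N ^ (k + 1)) x = 0) :
    x ∈ W k := by
  obtain ⟨b, hb⟩ := hW.eventually_top
  have key : ∀ d : ℕ, x ∈ W (k + d) → x ∈ W k := by
    intro d
    induction d with
    | zero => intro h; simpa using h
    | succ d ih =>
      intro h
      apply ih
      have hk : (0 : ℤ) ≤ k + (d + 1 : ℕ) := by positivity
      have hb := hW.bijective _ hk
      have h0 : (N ^ ((k : ℤ) + (d + 1 : ℕ)).toNat) x = 0 := by
        have : ((k : ℤ) + (d + 1 : ℕ)).toNat = d + (k + 1) := by omega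
        rw [this, pow_add, Module.End.mul_apply, hx, map_zero]
      have h1 := (inducedMap_mk_eq_zero W _ _ _ (hW.pow_maps _ hk) (hW.pow_maps' _ hk)
        ⟨x, h⟩).2 (by rw [h0]; exact Submodule.zero_mem _)
      have h2 := hb.1 (h1.trans (map_zero _).symm)
      rw [Submodule.Quotient.mk_eq_zero] at h2
      have h3 : x ∈ W ((k : ℤ) + (d + 1 : ℕ) - 1) := h2
      convert h3 using 2
      push_cast; ring
  apply key (b - k).toNat
  rw [hb _ (by omega)]
  trivial

/-- For `j ≤ l`, `N ^ j : W (2j - l) → W (-l)` is surjective. -/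
theorem IsMonodromyWeightFiltration.exists_pow_eq {W : ℤ → Submodule K V} {N : V →ₗ[K] V}
    (hW : IsMonodromyWeightFiltration W N) (j l : ℕ) (hjl : j ≤ l) (x : V)
    (hx : x ∈ W (-l)) : ∃ y ∈ W (2 * j - l), (N ^ j) y = x := by
  obtain ⟨a, ha⟩ := hW.eventually_bot
  have key : ∀ d l : ℕ, j ≤ l → -(l : ℤ) ≤ a + d → ∀ x ∈ W (-l),
      ∃ y ∈ W (2 * j - l), (N ^ j) y = x := by
    intro d
    induction d with
    | zero =>
      intro l _ h x hx
      rw [ha _ (by simpa using h)] at hx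
      rw [Submodule.mem_bot] at hx
      exact ⟨0, Submodule.zero_mem _, by simp [hx]⟩
    | succ d ih =>
      intro l hjl h x hx
      have hl : (0 : ℤ) ≤ l := by positivity
      obtain ⟨q, hq⟩ := (hW.bijective l hl).2 (Submodule.Quotient.mk ⟨x, hx⟩)
      obtain ⟨⟨y, hy⟩, rfl⟩ := Submodule.Quotient.mk_surjective _ q
      unfold inducedMap at hq
      erw [Submodule.mapQ_apply, Submodule.Quotient.eq] at hq
      have h3 : (N ^ (l : ℤ).toNat) y - x ∈ W (-l - 1) := hq
      rw [Int.toNat_natCast] at h3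
      obtain ⟨z, hz, hzx⟩ := ih (l + 1) (by omega) (by push_cast at h ⊢; omega)
        ((N ^ l) y - x) (by convert h3 using 2; push_cast; ring)
      refine ⟨(N ^ (l - j)) y - z, Submodule.sub_mem _ ?_ ?_, ?_⟩
      · exact hW.pow_mem (by omega) y hy
      · exact hW.mono (by push_cast; omega) hz
      · rw [map_sub, hzx, ← Module.End.mul_apply, ← pow_add, Nat.add_sub_cancel' hjl]
        abel
  exact key (-l - a).toNat l hjl (by omega) x hx

theorem map_pow_of_semicomm {N φ : V →ₗ[K] V} {c : K} (h : ∀ v, φ (N v) = c • N (φ v))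
    (j : ℕ) (v : V) : φ ((N ^ j) v) = c ^ j • (N ^ j) (φ v) := by
  induction j generalizing v with
  | zero => simp
  | succ n ih =>
    rw [pow_succ N, Module.End.mul_apply, ih, h, Module.End.mul_apply, map_smul, smul_smul,
      pow_succ c]

/-- A linear map commuting with `N` up to a nonzero scalar preserves `W`. -/
theorem IsMonodromyWeightFiltration.map_mem_of_semicomm {W : ℤ → Submodule K V}
    {N : V →ₗ[K] V} (hW : IsMonodromyWeightFiltration W N) {φ : V →ₗ[K] V} {c : K}
    (hc : c ≠ 0) (h : ∀ v, φ (N v) = c • N (φ v)) (k : ℤ) (x : V) (hx : x ∈ W k) :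
    φ x ∈ W k := by
  obtain ⟨b, hb⟩ := hW.eventually_top
  have key : ∀ d k : ℕ, b ≤ k + d → ∀ x ∈ W k, φ x ∈ W k := by
    intro d
    induction d with
    | zero =>
      intro k hk x _
      rw [hb _ (by simpa using hk)]
      trivial
    | succ d ih =>
      intro k hk x hx
      obtain ⟨y, hy, hyx⟩ := hW.exists_pow_eq (k + 2) (k + 2) le_rfl ((N ^ (k + 1)) x)
        (hW.pow_mem (by push_cast; ring) x hx)
      have hy' : y ∈ W ((k + 2 : ℕ) : ℤ) := by
        convert hy using 2
        push_cast; ring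
      have hp : (N ^ (k + 1)) (x - N y) = 0 := by
        rw [map_sub, ← hyx, pow_succ N (k + 1), Module.End.mul_apply, sub_self]
      have h1 : φ (x - N y) ∈ W k := by
        apply hW.ker_le
        have := map_pow_of_semicomm h (k + 1) (x - N y)
        rw [hp, map_zero] at this
        exact (smul_eq_zero.1 this.symm).resolve_left (pow_ne_zero _ hc)
      have h2 : φ (N y) ∈ W k := by
        rw [h]
        exact Submodule.smul_mem _ _ (hW.map_mem (by push_cast; ring) _
          (ih (k + 2) (by push_cast at hk ⊢; omega) y hy'))
      have := Submodule.add_mem _ h1 h2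
      rwa [map_sub, sub_add_cancel] at this
  have key' : ∀ k : ℕ, ∀ x ∈ W k, φ x ∈ W k := fun k => key (b - k).toNat k (by omega)
  rcases le_total 0 k with hk | hk
  · lift k to ℕ using hk
    exact key' k x hx
  · obtain ⟨l, rfl⟩ : ∃ l : ℕ, k = -l := ⟨(-k).toNat, by omega⟩
    obtain ⟨y, hy, rfl⟩ := hW.exists_pow_eq l l le_rfl x hx
    rw [map_pow_of_semicomm h]
    refine Submodule.smul_mem _ _ (hW.pow_mem (k := l) (by ring) _ (key' l y ?_))
    convert hy using 2
    ring

/-- A group acting on `V` compatibly with `N` up to a character `χ`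
preserves the monodromy weight filtration, and the induced automorphisms of the graded
pieces map each primitive part onto itself. -/
theorem monodromyWeightFiltration_group_action [FiniteDimensional K V]
    {N : V →ₗ[K] V} (hN : IsNilpotent N)
    {W : ℤ → Submodule K V} (hW : IsMonodromyWeightFiltration W N)
    {G : Type*} [Group G] (ρ : G →* (V ≃ₗ[K] V)) (χ : G →* Kˣ)
    (hcompat : ∀ g : G,
      (ρ g).toLinearMap ∘ₗ N ∘ₗ (ρ g).symm.toLinearMap = (χ g : K) • N) :
    ∀ g : G,
      (∀ k : ℤ, Submodule.map (ρ g).toLinearMap (W k) = W k) ∧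
      (∀ (k : ℤ) (hk : 0 ≤ k),
        ∀ (h1 : ∀ x ∈ W k, (ρ g).toLinearMap x ∈ W k)
          (h2 : ∀ x ∈ W (k - 1), (ρ g).toLinearMap x ∈ W (k - 1)),
        Submodule.map (inducedMap W (ρ g).toLinearMap k k h1 h2)
            (LinearMap.ker (inducedMap W (N ^ (k.toNat + 1)) k (-k - 2)
              (hW.pow_mem (by omega)) (hW.pow_mem (by omega)))) =
          LinearMap.ker (inducedMap W (N ^ (k.toNat + 1)) k (-k - 2)
              (hW.pow_mem (by omega)) (hW.pow_mem (by omega)))) := by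
  have hs : ∀ g v, (ρ g).toLinearMap (N v) = (χ g : K) • N ((ρ g).toLinearMap v) := by
    intro g v
    have := LinearMap.congr_fun (hcompat g) (ρ g v)
    simpa using this
  have hmem : ∀ g k, ∀ x ∈ W k, (ρ g).toLinearMap x ∈ W k := fun g =>
    hW.map_mem_of_semicomm (χ g).ne_zero (hs g)
  have hpow : ∀ (g : G) (j : ℕ) (m : ℤ) (x : V), (N ^ j) x ∈ W m →
      (N ^ j) ((ρ g).toLinearMap x) ∈ W m := by
    intro g j m x hx
    have h1 := hmem g m _ hx
    rw [map_pow_of_semicomm (hs g)] at h1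
    exact (Submodule.smul_mem_iff _ (pow_ne_zero _ (χ g).ne_zero)).1 h1
  have hinv : ∀ g x, (ρ g).toLinearMap ((ρ g⁻¹).toLinearMap x) = x := by
    intro g x
    have : (ρ g * ρ g⁻¹) x = x := by rw [← map_mul, mul_inv_cancel, map_one]; rfl
    exact this
  intro g
  refine ⟨fun k => le_antisymm ?_ ?_, fun k hk h1 h2 => le_antisymm ?_ ?_⟩
  · rintro _ ⟨x, hx, rfl⟩
    exact hmem g k x hx
  · intro x hx
    exact ⟨_, hmem g⁻¹ k x hx, hinv g x⟩
  · rintro _ ⟨q, hq, rfl⟩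
    obtain ⟨x, rfl⟩ := Submodule.Quotient.mk_surjective _ q
    have hq' := (inducedMap_mk_eq_zero W _ _ _ _ _ x).1 hq
    exact (inducedMap_mk_eq_zero W _ _ _ _ _ ⟨_, h1 x.1 x.2⟩).2 (hpow g _ _ _ hq')
  · intro q hq
    obtain ⟨x, rfl⟩ := Submodule.Quotient.mk_surjective _ q
    have hq' := (inducedMap_mk_eq_zero W _ _ _ _ _ x).1 hq
    refine ⟨Submodule.Quotient.mk ⟨_, hmem g⁻¹ k x.1 x.2⟩,
      (inducedMap_mk_eq_zero W _ _ _ _ _ _).2 (hpow g⁻¹ _ _ _ hq'), ?_⟩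
    unfold inducedMap
    erw [Submodule.mapQ_apply]
    congr 1
    exact Subtype.ext (hinv g x.1)
end
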